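/- arXiv:1708.01324 — 6 statements merged into one kernel-verified Lean document; each statement's English description precedes it below -/
import Mathlib

section
/- Let X be a random vector with finitely many realizations x^1,…,x^n in ℝ^d with probabilities q_1,…,q_n > 0 summing to 1, let p ∈ (0,1), and let η ∈ ℝ^d satisfy P(X ≤ η) = p (componentwise ≤). Then, componentwise, η + (1/(1−p))·E[(X − η)_+] = E[ max(X, η) | X ≰ η ], where X ≰ η means X_i > η_i for at least one index i, max(X,η) is the componentwise maximum, and ((X−η)_+)_i = max(0, X_i − η_i). (In particular the conditioning event has probability 1 − p > 0.) -/
open Finset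

attribute [local instance] Classical.propDecidable

noncomputable section

/-- The c.d.f. of a finitely supported random vector: `F(v) = P(X ≤ v)` (componentwise `≤`). -/
def cdfF {n d : ℕ} (q : Fin n → ℝ) (X : Fin n → Fin d → ℝ) (v : Fin d → ℝ) : ℝ :=
  ∑ s ∈ Finset.univ.filter (fun s => X s ≤ v), q s

/-- `η` is a p-level efficient point (pLEP) of `X`: `F(η) ≥ p` and no `y ≤ η`, `y ≠ η`, with `F(y) ≥ p`.
The set of all pLEPs is `MVaR_p(X)`. -/
def isPLEP {n d : ℕ} (q : Fin n → ℝ) (X : Fin n → Fin d → ℝ) (p : ℝ) (η : Fin d → ℝ) : Prop :=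
  p ≤ cdfF q X η ∧ ¬ ∃ y : Fin d → ℝ, y ≤ η ∧ y ≠ η ∧ p ≤ cdfF q X y

/-- `MCVaR_p(X, η) = η + (1/(1-p)) E[(X - η)_+]`, componentwise. -/
def MCVaR {n d : ℕ} (q : Fin n → ℝ) (X : Fin n → Fin d → ℝ) (p : ℝ) (η : Fin d → ℝ) :
    Fin d → ℝ :=
  fun i => η i + (1 / (1 - p)) * ∑ s, q s * max 0 (X s i - η i)

/-- `VMCVaR_p(X)`: the componentwise-minimal (non-dominated) elements of
`{MCVaR_p(X, η) : η ∈ MVaR_p(X)}`. -/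
def VMCVaR {n d : ℕ} (q : Fin n → ℝ) (X : Fin n → Fin d → ℝ) (p : ℝ) : Set (Fin d → ℝ) :=
  {v | (∃ η, isPLEP q X p η ∧ v = MCVaR q X p η) ∧
       ¬ ∃ u, (∃ η, isPLEP q X p η ∧ u = MCVaR q X p η) ∧ u ≤ v ∧ u ≠ v}

/-- Componentwise conditional expectation `E[Z | A]` for a finitely supported random vector. -/
def condExp {n d : ℕ} (q : Fin n → ℝ) (A : Fin n → Prop) (Z : Fin n → Fin d → ℝ) :
    Fin d → ℝ :=
  fun i => (∑ s ∈ Finset.univ.filter A, q s * Z s i) / (∑ s ∈ Finset.univ.filter A, q s)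

/-- If `P(X ≤ η) = p`, then componentwise
`η + (1/(1-p)) E[(X-η)_+] = E[max(X,η) | X ≰ η]`, and the conditioning event has
probability `1 - p > 0`. -/
theorem mcvar_eq_condExp_max {n d : ℕ} (q : Fin n → ℝ) (X : Fin n → Fin d → ℝ)
    (p : ℝ) (η : Fin d → ℝ)
    (hq : ∀ s, 0 < q s) (hsum : ∑ s, q s = 1) (hp0 : 0 < p) (hp1 : p < 1)
    (hη : ∑ s ∈ Finset.univ.filter (fun s => X s ≤ η), q s = p) :
    (∑ s ∈ Finset.univ.filter (fun s => ¬ X s ≤ η), q s = 1 - p) ∧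
    ∀ i : Fin d,
      MCVaR q X p η i
        = condExp q (fun s => ¬ X s ≤ η) (fun s i => max (X s i) (η i)) i := by
  have h1 : ∑ s ∈ Finset.univ.filter (fun s => ¬ X s ≤ η), q s = 1 - p := by
    have h := Finset.sum_filter_add_sum_filter_not Finset.univ (fun s => X s ≤ η) q
    rw [hsum] at h
    have h' : ∑ s ∈ Finset.univ.filter (fun s => X s ≤ η), q s
      + ∑ s ∈ Finset.univ.filter (fun s => ¬ X s ≤ η), q s = 1 := by
      convert h
    linarith
  refine ⟨h1, fun i => ?_⟩
  have h2 : ∑ s, q s * max 0 (X s i - η i)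
      = ∑ s ∈ Finset.univ.filter (fun s => ¬ X s ≤ η), q s * max 0 (X s i - η i) := by
    symm
    apply Finset.sum_subset (Finset.subset_univ _)
    intro s _ hs
    have hle : X s ≤ η := by
      by_contra hc
      exact hs (by simp [hc])
    rw [max_eq_left (sub_nonpos.mpr (hle i)), mul_zero]
  have h3 : ∑ s ∈ Finset.univ.filter (fun s => ¬ X s ≤ η), q s * max (X s i) (η i)
      = (1 - p) * η i
        + ∑ s ∈ Finset.univ.filter (fun s => ¬ X s ≤ η), q s * max 0 (X s i - η i) := by
    rw [← h1, Finset.sum_mul, ← Finset.sum_add_distrib]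
    refine Finset.sum_congr rfl fun s _ => ?_
    have : max (X s i) (η i) = η i + max 0 (X s i - η i) := by
      rw [← max_add_add_left, max_comm]; congr 1 <;> ring
    rw [this]; ring
  have hne : (1 - p) ≠ 0 := (sub_pos.mpr hp1).ne'
  have h4 : condExp q (fun s => ¬ X s ≤ η) (fun s i => max (X s i) (η i)) i
      = ((1 - p) * η i
        + ∑ s ∈ Finset.univ.filter (fun s => ¬ X s ≤ η), q s * max 0 (X s i - η i)) / (1 - p) := by
    rw [← h3, ← h1]
    unfold condExp
    congr!
  rw [h4]
  unfold MCVaR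
  rw [h2]
  field_simp

end
end

section
/- (Positive homogeneity of VMCVaR) Let X be a random vector with finitely many realizations in ℝ^d with positive probabilities summing to 1, let p ∈ (0,1), and let k ≥ 0 be a real number. Then for every ϑ ∈ VMCVaR_p(X), the vector kϑ belongs to VMCVaR_p(kX). -/
open Finset

attribute [local instance] Classical.propDecidable

noncomputable section

theorem aux_cdf {n d : ℕ} (q : Fin n → ℝ) (X : Fin n → Fin d → ℝ) (k : ℝ) (hk : 0 < k)
    (v : Fin d → ℝ) : cdfF q (fun s j => k * X s j) (fun i => k * v i) = cdfF q X v := by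
  unfold cdfF
  congr 1
  ext s
  simp only [Finset.mem_filter, Finset.mem_univ, true_and, Pi.le_def]
  exact forall_congr' fun i => mul_le_mul_iff_right₀ hk

theorem aux_plep {n d : ℕ} (q : Fin n → ℝ) (X : Fin n → Fin d → ℝ) (p k : ℝ) (hk : 0 < k)
    (v : Fin d → ℝ) (h : isPLEP q X p v) :
    isPLEP q (fun s j => k * X s j) p (fun i => k * v i) := by
  refine ⟨by rw [aux_cdf q X k hk]; exact h.1, ?_⟩
  rintro ⟨y, hy, hne, hp⟩
  have e : y = fun i => k * (k⁻¹ * y i) := by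
    funext i
    field_simp
  apply h.2
  refine ⟨fun i => k⁻¹ * y i, ?_, ?_, ?_⟩
  · intro i
    have := hy i
    rw [e] at this
    exact (mul_le_mul_iff_right₀ hk).1 this
  · intro hv
    apply hne
    rw [e, ← hv]
  · rw [e, aux_cdf q X k hk] at hp
    exact hp

theorem aux_mcvar {n d : ℕ} (q : Fin n → ℝ) (X : Fin n → Fin d → ℝ) (p k : ℝ) (hk : 0 ≤ k)
    (v : Fin d → ℝ) :
    MCVaR q (fun s j => k * X s j) p (fun i => k * v i) = fun i => k * MCVaR q X p v i := by
  funext i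
  simp only [MCVaR]
  have : ∀ s, q s * max 0 (k * X s i - k * v i) = k * (q s * max 0 (X s i - v i)) := by
    intro s
    rw [← mul_sub, ← mul_zero k, ← mul_max_of_nonneg _ _ hk, mul_zero]
    ring
  simp only [this, ← Finset.mul_sum]
  ring

theorem aux_zero {n d : ℕ} (q : Fin n → ℝ) (p : ℝ) (hsum : ∑ s, q s = 1) (hp0 : 0 < p)
    (hp1 : p < 1) (v : Fin d → ℝ) : isPLEP q (fun _ _ => 0) p v ↔ v = fun _ => 0 := by
  have key : ∀ y : Fin d → ℝ, p ≤ cdfF q (fun _ _ => 0) y ↔ (fun _ => 0) ≤ y := by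
    intro y
    unfold cdfF
    by_cases h : (fun _ => (0 : ℝ)) ≤ y
    · simp [h, hsum, hp1.le]
    · simp [h, hp0]
  unfold isPLEP
  simp only [key]
  constructor
  · rintro ⟨h1, h2⟩
    by_contra hne
    exact h2 ⟨_, h1, fun h => hne h.symm, le_refl _⟩
  · rintro rfl
    refine ⟨le_refl _, ?_⟩
    rintro ⟨y, h1, h2, h3⟩
    exact h2 (le_antisymm h1 h3)

/-- Positive homogeneity of `VMCVaR`: for `k ≥ 0`, if `ϑ ∈ VMCVaR_p(X)` then
`kϑ ∈ VMCVaR_p(kX)`. -/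
theorem vmcvar_pos_homogeneous {n d : ℕ} (q : Fin n → ℝ) (X : Fin n → Fin d → ℝ)
    (p : ℝ) (k : ℝ)
    (hq : ∀ s, 0 < q s) (hsum : ∑ s, q s = 1) (hp0 : 0 < p) (hp1 : p < 1) (hk : 0 ≤ k) :
    ∀ ϑ ∈ VMCVaR q X p,
      (fun i => k * ϑ i) ∈ VMCVaR q (fun s j => k * X s j) p := by
  rintro ϑ ⟨⟨η, hη, rfl⟩, hmin⟩
  rcases hk.eq_or_lt with rfl | hk
  · simp only [zero_mul]
    have m0 : MCVaR q (fun _ _ => (0 : ℝ)) p (fun _ => 0) = (fun _ : Fin d => (0 : ℝ)) := by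
      funext i
      simp [MCVaR]
    refine ⟨⟨fun _ => 0, (aux_zero q p hsum hp0 hp1 _).2 rfl, m0.symm⟩, ?_⟩
    rintro ⟨u, ⟨v, hv, rfl⟩, -, hne⟩
    rw [aux_zero q p hsum hp0 hp1] at hv
    subst hv
    exact hne m0
  · refine ⟨⟨fun i => k * η i, aux_plep q X p k hk η hη, (aux_mcvar q X p k hk.le η).symm⟩, ?_⟩
    rintro ⟨u, ⟨v, hv, rfl⟩, hle, hne⟩
    have hw := aux_plep q _ p k⁻¹ (inv_pos.2 hk) v hv
    have eX : (fun (s : Fin n) (j : Fin d) => k⁻¹ * (k * X s j)) = X := by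
      funext s j
      field_simp
    rw [eX] at hw
    have e : v = fun i => k * (k⁻¹ * v i) := by
      funext i
      field_simp
    have em := aux_mcvar q X p k hk.le (fun i => k⁻¹ * v i)
    rw [← e] at em
    rw [em] at hle hne
    refine hmin ⟨_, ⟨_, hw, rfl⟩, fun i => (mul_le_mul_iff_right₀ hk).1 (hle i), ?_⟩
    intro h
    apply hne
    rw [h]

end
end

section
/- (Translation equivariance of VMCVaR) Let X be a random vector with finitely many realizations in ℝ^d with positive probabilities summing to 1, let p ∈ (0,1), and let k ∈ ℝ^d be a deterministic vector. Then for every ϑ ∈ VMCVaR_p(X), the vector ϑ + k belongs to VMCVaR_p(X + k). -/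
open Finset

attribute [local instance] Classical.propDecidable

noncomputable section

theorem cdfF_shift {n d : ℕ} (q : Fin n → ℝ) (X : Fin n → Fin d → ℝ) (k v : Fin d → ℝ) :
    cdfF q (fun s j => X s j + k j) v = cdfF q X (v - k) := by
  unfold cdfF
  have h : ∀ s, ((fun j => X s j + k j) ≤ v) = (X s ≤ v - k) := by
    intro s
    apply propext
    exact (le_sub_iff_add_le (a := X s) (b := k) (c := v)).symm
  simp only [h]

theorem isPLEP_shift {n d : ℕ} (q : Fin n → ℝ) (X : Fin n → Fin d → ℝ) (p : ℝ)
    (k η : Fin d → ℝ) :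
    isPLEP q (fun s j => X s j + k j) p η ↔ isPLEP q X p (η - k) := by
  unfold isPLEP
  simp only [cdfF_shift]
  refine and_congr_right fun _ => not_congr ⟨?_, ?_⟩
  · rintro ⟨y, h1, h2, h3⟩
    exact ⟨y - k, sub_le_sub_right h1 k, fun h => h2 (sub_left_injective h), h3⟩
  · rintro ⟨y, h1, h2, h3⟩
    refine ⟨y + k, le_sub_iff_add_le.mp h1, fun h => h2 (eq_sub_of_add_eq h), ?_⟩
    rwa [add_sub_cancel_right]

theorem MCVaR_shift {n d : ℕ} (q : Fin n → ℝ) (X : Fin n → Fin d → ℝ) (p : ℝ)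
    (k η : Fin d → ℝ) :
    MCVaR q (fun s j => X s j + k j) p η = MCVaR q X p (η - k) + k := by
  funext i
  have h : ∀ s, X s i + k i - η i = X s i - (η i - k i) := fun s => by ring
  simp only [MCVaR, Pi.add_apply, Pi.sub_apply, h]
  ring

/-- Translation equivariance of `VMCVaR`: for a deterministic `k ∈ ℝ^d`,
if `ϑ ∈ VMCVaR_p(X)` then `ϑ + k ∈ VMCVaR_p(X + k)`. -/
theorem vmcvar_translation_equivariant {n d : ℕ} (q : Fin n → ℝ) (X : Fin n → Fin d → ℝ)
    (p : ℝ) (k : Fin d → ℝ)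
    (hq : ∀ s, 0 < q s) (hsum : ∑ s, q s = 1) (hp0 : 0 < p) (hp1 : p < 1) :
    ∀ ϑ ∈ VMCVaR q X p,
      (fun i => ϑ i + k i) ∈ VMCVaR q (fun s j => X s j + k j) p := by
  rintro ϑ ⟨⟨η, hη, rfl⟩, hmin⟩
  refine ⟨⟨η + k, ?_, ?_⟩, ?_⟩
  · rw [isPLEP_shift, add_sub_cancel_right]
    exact hη
  · rw [MCVaR_shift, add_sub_cancel_right]
    rfl
  · rintro ⟨u, ⟨ζ, hζ, rfl⟩, hle, hne⟩
    rw [isPLEP_shift] at hζ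
    rw [MCVaR_shift] at hle hne
    refine hmin ⟨_, ⟨ζ - k, hζ, rfl⟩, ?_, ?_⟩
    · exact (add_le_add_iff_right k).mp hle
    · intro h
      apply hne
      rw [h]
      rfl

end
end

section
/- Let X and Y be random vectors on a common finite probability space with scenario probabilities q_1,…,q_n > 0 summing to 1 and realizations x^s, y^s ∈ ℝ^d, and suppose X ≤ Y, i.e., x^s ≤ y^s componentwise for every scenario s. Let p ∈ (0,1) and let η₁, η₂ ∈ ℝ^d satisfy η₁ ≤ η₂ componentwise and P(X ≤ η₁) ≥ p. Then MCVaR_p(X, η₁) ≤ MCVaR_p(Y, η₂) componentwise, i.e., η₁ + (1/(1−p))·Σ_s q_s (x^s − η₁)_+ ≤ η₂ + (1/(1−p))·Σ_s q_s (y^s − η₂)_+. -/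
open Finset

attribute [local instance] Classical.propDecidable

noncomputable section

/-- If `X ≤ Y` scenariowise, `η₁ ≤ η₂`, and `P(X ≤ η₁) ≥ p`, then
`MCVaR_p(X, η₁) ≤ MCVaR_p(Y, η₂)` componentwise. -/
theorem mcvar_monotone {n d : ℕ} (q : Fin n → ℝ) (X Y : Fin n → Fin d → ℝ)
    (p : ℝ) (η₁ η₂ : Fin d → ℝ)
    (hq : ∀ s, 0 < q s) (hsum : ∑ s, q s = 1) (hp0 : 0 < p) (hp1 : p < 1)
    (hXY : ∀ s, X s ≤ Y s) (hη : η₁ ≤ η₂)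
    (hP : p ≤ ∑ s ∈ Finset.univ.filter (fun s => X s ≤ η₁), q s) :
    MCVaR q X p η₁ ≤ MCVaR q Y p η₂ := by
  intro i
  have hi : η₁ i ≤ η₂ i := hη i
  have key : ∀ s, q s * max 0 (X s i - η₁ i) ≤ q s * max 0 (Y s i - η₂ i)
      + (q s - if X s ≤ η₁ then q s else 0) * (η₂ i - η₁ i) := by
    intro s
    have hs := hq s
    have hxy : X s i ≤ Y s i := hXY s i
    have h0 : 0 ≤ max 0 (Y s i - η₂ i) := le_max_left _ _
    have h1 : Y s i - η₂ i ≤ max 0 (Y s i - η₂ i) := le_max_right _ _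
    by_cases h : X s ≤ η₁
    · have hx : X s i ≤ η₁ i := h i
      rw [max_eq_left (by linarith : X s i - η₁ i ≤ 0)]
      simp only [h, if_true]
      nlinarith [mul_nonneg hs.le h0]
    · simp only [h, if_false]
      have h2 : max 0 (X s i - η₁ i) ≤ max 0 (Y s i - η₂ i) + (η₂ i - η₁ i) :=
        max_le (by linarith) (by linarith)
      nlinarith [mul_le_mul_of_nonneg_left h2 hs.le]
  have hS := Finset.sum_le_sum (fun s (_ : s ∈ Finset.univ) => key s)
  rw [Finset.sum_add_distrib, ← Finset.sum_mul, Finset.sum_sub_distrib, hsum,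
    ← Finset.sum_filter] at hS
  have hp : 0 < 1 - p := by linarith
  have hb := mul_le_mul_of_nonneg_right hP (sub_nonneg.2 hi)
  have hT : ∑ s, q s * max 0 (X s i - η₁ i) ≤ ∑ s, q s * max 0 (Y s i - η₂ i)
      + (1 - p) * (η₂ i - η₁ i) := by linarith
  have hD := mul_le_mul_of_nonneg_left hT (one_div_pos.2 hp).le
  rw [mul_add, ← mul_assoc, one_div_mul_cancel hp.ne', one_mul] at hD
  show η₁ i + (1 / (1 - p)) * ∑ s, q s * max 0 (X s i - η₁ i)
    ≤ η₂ i + (1 / (1 - p)) * ∑ s, q s * max 0 (Y s i - η₂ i)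
  linarith
end
end

section
/- Let X be the bivariate random vector taking the values (1,5), (2,4), (3,3), (4,2), (5,1) with probabilities 0.05, 0.3, 0.3, 0.3, 0.05 respectively, and let p = 0.9. Then MVaR_{0.9}(X) = {(4,4)}, the undesirable realizations (those x with x ≰ (4,4)) are exactly (1,5) and (5,1), and E[X | X ≰ (4,4)] = (3,3), which is componentwise strictly smaller than the unique pLEP (4,4). Hence the conditional expectation of the undesirable outcomes strictly dominates (is preferable to) the multivariate VaR, and ψ((3,3)) < ψ((4,4)) for every componentwise strictly increasing function ψ : ℝ^2 → ℝ. -/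
open Finset

attribute [local instance] Classical.propDecidable

noncomputable section

/-- The bivariate random vector taking values `(1,5), (2,4), (3,3), (4,2), (5,1)`. -/
def Xex : Fin 5 → Fin 2 → ℝ := ![![1, 5], ![2, 4], ![3, 3], ![4, 2], ![5, 1]]

/-- The probabilities `0.05, 0.3, 0.3, 0.3, 0.05`. -/
def qex : Fin 5 → ℝ := ![1 / 20, 3 / 10, 3 / 10, 3 / 10, 1 / 20]

theorem cdf_ge_iff (v : Fin 2 → ℝ) :
    9 / 10 ≤ cdfF qex Xex v ↔ (4 ≤ v 0 ∧ 4 ≤ v 1) := by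
  unfold cdfF
  rw [Finset.sum_filter]
  simp only [Fin.sum_univ_five, Pi.le_def, Fin.forall_fin_two, Xex, qex]
  simp
  constructor
  · intro h
    by_contra hc
    have h2 : ¬ ((2 ≤ v 0 ∧ 4 ≤ v 1) ∧ (4 ≤ v 0 ∧ 2 ≤ v 1)) := fun h' => hc ⟨h'.2.1, h'.1.2⟩
    revert h
    rcases not_and_or.mp h2 with h2 | h2 <;> rw [if_neg h2] <;> clear h2 hc <;>
      split_ifs <;> norm_num
  · rintro ⟨h0, h1⟩
    have a : 2 ≤ v 0 := by linarith
    have b : 2 ≤ v 1 := by linarith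
    have c : 3 ≤ v 0 := by linarith
    have d : 3 ≤ v 1 := by linarith
    simp only [a, b, c, d, h0, h1, and_self, if_true]
    split_ifs <;> norm_num

theorem bad_iff (s : Fin 5) : (¬ Xex s ≤ ![4, 4]) ↔ (s = 0 ∨ s = 4) := by
  fin_cases s <;> simp [Xex, Pi.le_def, Fin.forall_fin_two] <;> norm_num

/-- At `p = 0.9`: `MVaR_{0.9}(X) = {(4,4)}`; the undesirable scenarios
(`x ≰ (4,4)`) are exactly those with realizations `(1,5)` and `(5,1)`;
`E[X | X ≰ (4,4)] = (3,3) < (4,4)` componentwise; hence `ψ((3,3)) < ψ((4,4))` for every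
componentwise strictly increasing `ψ`. -/
theorem example_prekopa_dominates_var :
    ({η | isPLEP qex Xex (9 / 10) η} = ({![4, 4]} : Set (Fin 2 → ℝ))) ∧
    ({s : Fin 5 | ¬ Xex s ≤ ![4, 4]} = ({0, 4} : Set (Fin 5))) ∧
    condExp qex (fun s => ¬ Xex s ≤ ![4, 4]) Xex = ![3, 3] ∧
    (∀ i : Fin 2, (![3, 3] : Fin 2 → ℝ) i < (![4, 4] : Fin 2 → ℝ) i) ∧
    (∀ ψ : (Fin 2 → ℝ) → ℝ,
      (∀ u v : Fin 2 → ℝ, (∀ i, u i < v i) → ψ u < ψ v) →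
      ψ ![3, 3] < ψ ![4, 4]) := by
  have hlt : ∀ i : Fin 2, (![3, 3] : Fin 2 → ℝ) i < (![4, 4] : Fin 2 → ℝ) i := by
    intro i
    fin_cases i <;> norm_num
  refine ⟨?_, ?_, ?_, hlt, fun ψ h => h _ _ hlt⟩
  · ext η
    simp only [Set.mem_setOf_eq, Set.mem_singleton_iff, isPLEP, cdf_ge_iff]
    constructor
    · rintro ⟨⟨h0, h1⟩, h⟩
      by_contra hne
      refine h ⟨![4, 4], ?_, fun e => hne e.symm, by simp⟩
      rw [Pi.le_def, Fin.forall_fin_two]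
      exact ⟨h0, h1⟩
    · rintro rfl
      refine ⟨by simp, ?_⟩
      rintro ⟨y, hy, hne, h0, h1⟩
      apply hne
      refine le_antisymm hy ?_
      rw [Pi.le_def, Fin.forall_fin_two]
      exact ⟨h0, h1⟩
  · ext s
    simp only [Set.mem_setOf_eq, bad_iff, Set.mem_insert_iff, Set.mem_singleton_iff]
  · funext i
    simp only [condExp, bad_iff, Finset.sum_filter, Fin.sum_univ_five]
    fin_cases i <;> simp [Xex, qex] <;> norm_num

end
end

section
/- Let X be a random vector with finitely many realizations x^1,…,x^n in ℝ^d with probabilities q_1,…,q_n > 0 summing to 1, let p ∈ (0,1), and let η ∈ ℝ^d satisfy P(X ≤ η) = p. Suppose the event A = {X_i ≥ η_i for some i} has positive probability. Then, componentwise, E[X | A] ≤ η + (1/(1−p))·E[(X − η)_+] = E[ max(X, η) | X ≰ η ]; that is, the vector-valued adaptation of Prékopa's multivariate CVaR is dominated by MCVaR_p(X, η). -/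
open Finset

attribute [local instance] Classical.propDecidable

noncomputable section

/-- If `P(X ≤ η) = p` and the event `A = {X_i ≥ η_i for some i}` has positive
probability, then componentwise
`E[X | A] ≤ η + (1/(1-p)) E[(X-η)_+] = E[max(X,η) | X ≰ η]`;
i.e. the vector-valued adaptation of Prékopa's multivariate CVaR is dominated by
`MCVaR_p(X, η)`. -/
theorem prekopa_le_mcvar {n d : ℕ} (q : Fin n → ℝ) (X : Fin n → Fin d → ℝ)
    (p : ℝ) (η : Fin d → ℝ)
    (hq : ∀ s, 0 < q s) (hsum : ∑ s, q s = 1) (hp0 : 0 < p) (hp1 : p < 1)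
    (hPeq : ∑ s ∈ Finset.univ.filter (fun s => X s ≤ η), q s = p)
    (hA : 0 < ∑ s ∈ Finset.univ.filter (fun s => ∃ i, η i ≤ X s i), q s) :
    condExp q (fun s => ∃ i, η i ≤ X s i) X ≤ MCVaR q X p η ∧
    MCVaR q X p η = condExp q (fun s => ¬ X s ≤ η) (fun s i => max (X s i) (η i)) := by
  have key : ∀ s i, 0 ≤ q s * max 0 (X s i - η i) := fun s i =>
    mul_nonneg (hq s).le (le_max_left _ _)
  have hB : ∑ s ∈ Finset.univ.filter (fun s => ¬ X s ≤ η), q s = 1 - p := by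
    have h := Finset.sum_filter_add_sum_filter_not Finset.univ (fun s => X s ≤ η) q
    rw [hsum] at h
    have h2 : ∑ s ∈ Finset.univ.filter (fun s => X s ≤ η), q s
        + ∑ s ∈ Finset.univ.filter (fun s => ¬ X s ≤ η), q s = 1 := by
      convert h
    linarith
  have h1p : 0 < 1 - p := by linarith
  constructor
  · intro i
    have ha : 1 - p ≤ ∑ s ∈ Finset.univ.filter (fun s => ∃ i, η i ≤ X s i), q s := by
      rw [← hB]
      apply Finset.sum_le_sum_of_subset_of_nonneg
      · intro s hs
        simp only [Finset.mem_filter, Finset.mem_univ, true_and] at hs ⊢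
        rw [Pi.le_def] at hs
        push Not at hs
        obtain ⟨j, hj⟩ := hs
        exact ⟨j, hj.le⟩
      · intro s _ _
        exact (hq s).le
    have hS : 0 ≤ ∑ s, q s * max 0 (X s i - η i) := Finset.sum_nonneg fun s _ => key s i
    have hle : ∑ s ∈ Finset.univ.filter (fun s => ∃ i, η i ≤ X s i), q s * X s i ≤
        η i * (∑ s ∈ Finset.univ.filter (fun s => ∃ i, η i ≤ X s i), q s)
          + ∑ s, q s * max 0 (X s i - η i) := by
      calc _ ≤ ∑ s ∈ Finset.univ.filter (fun s => ∃ i, η i ≤ X s i),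
              (η i * q s + q s * max 0 (X s i - η i)) := by
            apply Finset.sum_le_sum
            intro s _
            nlinarith [mul_le_mul_of_nonneg_left (le_max_right 0 (X s i - η i)) (hq s).le]
        _ ≤ _ := by
            rw [Finset.sum_add_distrib, Finset.mul_sum]
            gcongr
            · exact fun s _ _ => key s i
            · exact Finset.filter_subset _ _
    have hgoal : (∑ s ∈ Finset.univ.filter (fun s => ∃ i, η i ≤ X s i), q s * X s i) /
        (∑ s ∈ Finset.univ.filter (fun s => ∃ i, η i ≤ X s i), q s) ≤ MCVaR q X p η i := by
      unfold MCVaR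
      rw [div_le_iff₀ hA]
      refine hle.trans ?_
      rw [add_mul]
      gcongr
      generalize (∑ s ∈ Finset.univ.filter (fun s => ∃ i, η i ≤ X s i), q s) = a at *
      generalize (∑ s, q s * max 0 (X s i - η i)) = S at *
      rw [one_div, ← div_eq_inv_mul, div_mul_eq_mul_div, le_div_iff₀ h1p]
      gcongr
    unfold condExp
    convert hgoal
  · funext i
    have hB' : ∑ s, q s * max 0 (X s i - η i) =
        ∑ s ∈ Finset.univ.filter (fun s => ¬ X s ≤ η), q s * max 0 (X s i - η i) := by
      symm
      apply Finset.sum_subset (Finset.filter_subset _ _)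
      intro s _ hs
      simp only [Finset.mem_filter, Finset.mem_univ, true_and, not_not] at hs
      rw [max_eq_left (by linarith [hs i]), mul_zero]
    have hE : ∑ s ∈ Finset.univ.filter (fun s => ¬ X s ≤ η), q s * max (X s i) (η i) =
        η i * (1 - p) + ∑ s, q s * max 0 (X s i - η i) := by
      rw [hB', ← hB, Finset.mul_sum, ← Finset.sum_add_distrib]
      apply Finset.sum_congr rfl
      intro s _
      have : max (X s i) (η i) = η i + max 0 (X s i - η i) := by
        rw [← max_add_add_left, max_comm]
        simp
      rw [this]
      ring
    have hgoal : MCVaR q X p η i = (∑ s ∈ Finset.univ.filter (fun s => ¬ X s ≤ η),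
        q s * max (X s i) (η i)) / (∑ s ∈ Finset.univ.filter (fun s => ¬ X s ≤ η), q s) := by
      rw [hE, hB]
      unfold MCVaR
      field_simp
    rw [hgoal]
    unfold condExp
    congr!

end
end
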